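/- Let P, W, V be n×n complex matrices such that P is an orthogonal projection (P* = P and P·P = P), W is unitary (W*·W = W·W* = I), V satisfies P·V = V = V·P and V·V* = V*·V = P, and P·W·P = (1/2)·V. Define A = −W·(I − 2P)·W*·(I − 2P)·W. Then P·A·P = V. -/

import Mathlib

open Matrix

/-- oblivious amplitude amplification identity `P·A·P = V`, with
`A = −W(I − 2P)W*(I − 2P)W`. -/
theorem stmt_12 (n : ℕ) (P W V : Matrix (Fin n) (Fin n) ℂ)
    (hP : Pᴴ = P ∧ P * P = P)
    (hW : Wᴴ * W = 1 ∧ W * Wᴴ = 1)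
    (hV₁ : P * V = V) (hV₂ : V * P = V)
    (hV₃ : V * Vᴴ = P) (hV₄ : Vᴴ * V = P)
    (hPWP : P * W * P = (2⁻¹ : ℂ) • V) :
    P * (-(W * (1 - (2 : ℂ) • P) * Wᴴ * (1 - (2 : ℂ) • P) * W)) * P = V := by
  obtain ⟨hPH, hPP⟩ := hP
  obtain ⟨hW₁, hW₂⟩ := hW
  have hPWHP : P * Wᴴ * P = (2⁻¹ : ℂ) • Vᴴ := by
    have h := congrArg conjTranspose hPWP
    simpa [conjTranspose_mul, hPH, Matrix.mul_assoc] using h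
  have h₁ : P * W * P * Wᴴ * W * P = (2⁻¹ : ℂ) • V := by
    rw [Matrix.mul_assoc (P * W * P), hW₁, Matrix.mul_one, Matrix.mul_assoc, hPP, hPWP]
  have h₂ : P * W * Wᴴ * P * W * P = (2⁻¹ : ℂ) • V := by
    rw [Matrix.mul_assoc P W, hW₂, Matrix.mul_one, hPP, hPWP]
  have h₃ : P * W * Wᴴ * W * P = (2⁻¹ : ℂ) • V := by
    rw [Matrix.mul_assoc P W, hW₂, Matrix.mul_one, hPWP]
  have h₄ : P * W * P * Wᴴ * P * W * P = (8⁻¹ : ℂ) • V := by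
    calc P * W * P * Wᴴ * P * W * P
        = P * W * (P * P) * Wᴴ * (P * P) * W * P := by rw [hPP]
      _ = (P * W * P) * (P * Wᴴ * P) * (P * W * P) := by simp only [Matrix.mul_assoc]
      _ = (8⁻¹ : ℂ) • V := by
        rw [hPWP, hPWHP]
        simp only [smul_mul_assoc, mul_smul_comm, smul_smul, hV₃, hV₁]
        norm_num
  calc P * (-(W * (1 - (2 : ℂ) • P) * Wᴴ * (1 - (2 : ℂ) • P) * W)) * P
      = -(P * W * Wᴴ * W * P) + (2 : ℂ) • (P * W * P * Wᴴ * W * P)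
        + (2 : ℂ) • (P * W * Wᴴ * P * W * P)
        - (4 : ℂ) • (P * W * P * Wᴴ * P * W * P) := by
        simp only [mul_sub, sub_mul, mul_neg, neg_mul, smul_mul_assoc, mul_smul_comm,
          mul_one, ← mul_assoc]
        module
    _ = V := by
        rw [h₁, h₂, h₃, h₄]
        module
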